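/- Let C = ⟨(b(x) | 0), (ℓ(x) | a(x))⟩ be a Z₂-double cyclic code with b(x) | x^r−1, a(x) | x^s−1, the subcode {(p(x) | 0) ∈ C} equal to ⟨(b(x) | 0)⟩, and a(x) generating C_s. Let ā(x) be the monic polynomial dividing x^s−1 that generates the projection (C^⊥)_s of the dual code on the second factor. Then ā(x) = (x^s−1)·gcd(b(x), ℓ(x))* / (a*(x)·b*(x)). -/

import Mathlib

open Polynomial

noncomputable section

/-- The polynomial ring `Z₂[x]`. -/
abbrev Z2P : Type := Polynomial (ZMod 2)

/-- The quotient ring `Z₂[x]/(x^n - 1)`. -/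
abbrev Rq (n : ℕ) : Type := Z2P ⧸ Ideal.span {(X : Z2P) ^ n - 1}

/-- The canonical projection `Z₂[x] → Z₂[x]/(x^n - 1)`. -/
def mkQ (n : ℕ) : Z2P →+* Rq n := Ideal.Quotient.mk _

/-- The element of `Z₂[x]/(x^n − 1)` associated to a vector `v ∈ Z₂^n` via coefficients. -/
def ofVec (n : ℕ) (v : Fin n → ZMod 2) : Rq n :=
  mkQ n (∑ i : Fin n, Polynomial.C (v i) * (X : Z2P) ^ (i : ℕ))

/-- The dual code `C^⊥` of a `Z₂`-double cyclic code `C ⊆ R_{r,s}`, computed with respect to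
the standard inner product on `Z₂^{r+s}` under the coefficient identification
`R_{r,s} ≅ Z₂^r × Z₂^s`. -/
def dualCode (r s : ℕ) (C : Submodule Z2P (Rq r × Rq s)) : Set (Rq r × Rq s) :=
  {c | ∃ w : (Fin r → ZMod 2) × (Fin s → ZMod 2),
        (ofVec r w.1, ofVec s w.2) = c ∧
        ∀ u : (Fin r → ZMod 2) × (Fin s → ZMod 2),
          (ofVec r u.1, ofVec s u.2) ∈ C →
          (∑ i, u.1 i * w.1 i) + (∑ j, u.2 j * w.2 j) = 0}

section

variable {K : Type*} [Field K]

/-- The polynomial whose coefficients are the entries of a vector. -/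
def vecPoly (n : ℕ) (v : Fin n → K) : K[X] := ∑ i : Fin n, C (v i) * X ^ (i : ℕ)

theorem coeff_vecPoly (n : ℕ) (v : Fin n → K) (k : ℕ) :
    (vecPoly n v).coeff k = if h : k < n then v ⟨k, h⟩ else 0 := by
  simp only [vecPoly, finsetSum_coeff, coeff_C_mul, coeff_X_pow]
  split_ifs with h
  · rw [Finset.sum_eq_single ⟨k, h⟩]
    · simp
    · rintro ⟨i, hi⟩ - hne
      have : k ≠ i := fun e => hne (by simp [e])
      simp [this]
    · simp
  · refine Finset.sum_eq_zero fun i _ => ?_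
    have : k ≠ i := by omega
    simp [this]

theorem vecPoly_add (n : ℕ) (v w : Fin n → K) :
    vecPoly n (v + w) = vecPoly n v + vecPoly n w := by
  ext k
  simp only [coeff_add, coeff_vecPoly]
  split_ifs <;> simp

theorem vecPoly_smul (n : ℕ) (c : K) (v : Fin n → K) :
    vecPoly n (c • v) = C c * vecPoly n v := by
  ext k
  simp only [coeff_C_mul, coeff_vecPoly]
  split_ifs <;> simp

theorem natDegree_vecPoly_le (n : ℕ) (v : Fin n → K) : (vecPoly n v).natDegree ≤ n - 1 := by
  rw [natDegree_le_iff_coeff_eq_zero]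
  intro k hk
  rw [coeff_vecPoly, dif_neg (by omega)]

theorem vecPoly_coeff {n : ℕ} (hn : 0 < n) {p : K[X]} (hp : p.natDegree ≤ n - 1) :
    vecPoly n (fun i : Fin n => p.coeff i) = p := by
  ext k
  rw [coeff_vecPoly]
  split_ifs with h
  · rfl
  · exact (coeff_eq_zero_of_natDegree_lt (by omega)).symm

theorem monic_X_pow_sub_one {n : ℕ} (hn : 0 < n) : ((X : K[X]) ^ n - 1).Monic := by
  simpa using monic_X_pow_sub_C (1 : K) hn.ne'

theorem natDegree_X_pow_sub_one (n : ℕ) : ((X : K[X]) ^ n - 1).natDegree = n := by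
  simpa using natDegree_X_pow_sub_C (n := n) (r := (1 : K))

theorem natDegree_modByMonic_X_pow_sub_one_le {n : ℕ} (hn : 0 < n) (p : K[X]) :
    (p %ₘ (X ^ n - 1)).natDegree ≤ n - 1 := by
  have := natDegree_modByMonic_lt p (monic_X_pow_sub_one (K := K) hn)
    (fun h => by
      have := natDegree_X_pow_sub_one (K := K) n
      rw [h] at this
      simp at this
      omega)
  rw [natDegree_X_pow_sub_one] at this
  omega

theorem sum_mul_eq_coeff_mul_reflect {n : ℕ} (hn : 0 < n) (u w : Fin n → K) :
    ∑ i, u i * w i = (vecPoly n u * reflect (n - 1) (vecPoly n w)).coeff (n - 1) := by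
  obtain ⟨m, rfl⟩ : ∃ m, n = m + 1 := ⟨n - 1, by omega⟩
  rw [coeff_mul, Finset.Nat.sum_antidiagonal_eq_sum_range_succ
    (fun i j => (vecPoly (m + 1) u).coeff i * (reflect (m + 1 - 1) (vecPoly (m + 1) w)).coeff j),
    Finset.sum_range]
  refine Finset.sum_congr rfl fun i _ => ?_
  have hi : (i : ℕ) ≤ m := by omega
  simp only [Nat.add_sub_cancel]
  rw [coeff_reflect, revAt_le (by omega), Nat.sub_sub_self hi]
  simp [coeff_vecPoly, hi]

theorem coeff_modByMonic_X_pow_sub_one {n : ℕ} (hn : 0 < n) {p : K[X]}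
    (hp : p.natDegree ≤ (n - 1) + (n - 1)) :
    (p %ₘ (X ^ n - 1)).coeff (n - 1) = p.coeff (n - 1) := by
  have hq : (p /ₘ (X ^ n - 1)).coeff (n - 1) = 0 := by
    by_cases h0 : p /ₘ (X ^ n - 1) = 0
    · simp [h0]
    rcases Nat.lt_or_ge 1 n with h1 | h1
    · apply coeff_eq_zero_of_natDegree_lt
      rw [natDegree_divByMonic _ (monic_X_pow_sub_one hn), natDegree_X_pow_sub_one]
      omega
    · exfalso
      apply h0
      rw [divByMonic_eq_zero_iff (monic_X_pow_sub_one hn)]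
      apply degree_lt_degree
      rw [natDegree_X_pow_sub_one]
      omega
  conv_rhs => rw [← modByMonic_add_div p (X ^ n - 1)]
  rw [coeff_add, sub_mul, one_mul, coeff_sub, hq, coeff_X_pow_mul', if_neg (by omega)]
  simp

theorem X_pow_sub_one_dvd_of_coeff_modByMonic {n : ℕ} (hn : 0 < n) {p : K[X]}
    (h : ∀ i, ((X ^ i * p) %ₘ (X ^ n - 1)).coeff (n - 1) = 0) : (X ^ n - 1) ∣ p := by
  rw [← modByMonic_eq_zero_iff_dvd (monic_X_pow_sub_one hn)]
  by_contra hr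
  set r := p %ₘ (X ^ n - 1) with hrdef
  have hrd : r.natDegree ≤ n - 1 := natDegree_modByMonic_X_pow_sub_one_le hn p
  have hmod : (X ^ (n - 1 - r.natDegree) * p) %ₘ (X ^ n - 1) =
      (X ^ (n - 1 - r.natDegree) * r) %ₘ (X ^ n - 1) := by
    refine modByMonic_eq_of_dvd_sub (monic_X_pow_sub_one hn) ?_
    rw [← mul_sub, ← dvd_neg, ← mul_neg, neg_sub]
    exact (dvd_modByMonic_sub p _).mul_left _
  have h1 := h (n - 1 - r.natDegree)
  rw [hmod, coeff_modByMonic_X_pow_sub_one hn, coeff_X_pow_mul', if_pos (by omega),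
    Nat.sub_sub_self hrd] at h1
  · exact hr (leadingCoeff_eq_zero.mp h1)
  · refine natDegree_mul_le.trans ?_
    rw [natDegree_X_pow]
    omega

theorem reverse_dvd_reflect {m : ℕ} {h p : K[X]} (hp : p.natDegree ≤ m) (hd : h ∣ p) :
    h.reverse ∣ reflect m p := by
  obtain ⟨k, rfl⟩ := hd
  rcases eq_or_ne (h * k) 0 with h0 | h0
  · simp [h0]
  rw [natDegree_mul (left_ne_zero_of_mul h0) (right_ne_zero_of_mul h0)] at hp
  obtain ⟨e, rfl⟩ : ∃ e, m = h.natDegree + e := ⟨m - h.natDegree, by omega⟩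
  rw [reflect_mul _ _ le_rfl (by omega)]
  exact dvd_mul_right _ _

theorem natDegree_reflect_le_of_le {m : ℕ} {p : K[X]} (hp : p.natDegree ≤ m) :
    (reflect m p).natDegree ≤ m := by
  simpa [hp] using natDegree_reflect_le (N := m) (p := p)

theorem reverse_reverse_of_coeff_zero {h : K[X]} (h0 : h.coeff 0 ≠ 0) :
    h.reverse.reverse = h := by
  have := reverse_natDegree h
  rw [natTrailingDegree_eq_zero_of_constantCoeff_ne_zero h0, Nat.sub_zero] at this
  rw [reverse, this, reverse, reflect_reflect]

theorem dvd_reflect_iff {m : ℕ} {h p : K[X]} (h0 : h.coeff 0 ≠ 0) (hp : p.natDegree ≤ m) :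
    h ∣ reflect m p ↔ h.reverse ∣ p := by
  constructor
  · intro hd
    simpa using reverse_dvd_reflect (natDegree_reflect_le_of_le hp) hd
  · intro hd
    simpa [reverse_reverse_of_coeff_zero h0] using reverse_dvd_reflect hp hd

theorem reverse_X_pow_sub_one (n : ℕ) :
    ((X : K[X]) ^ n - 1).reverse = -(X ^ n - 1) := by
  rw [reverse, natDegree_X_pow_sub_one, reflect_sub]
  have h1 := reflect_monomial (R := K) n n
  have h2 := reflect_monomial (R := K) n 0
  simp_all

/-- The dual of a cyclic code `⟨f⟩` with `f * h = X ^ n - 1` is the cyclic code `⟨h*⟩`. -/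
theorem forall_sum_mul_eq_zero_iff {n : ℕ} (hn : 0 < n) {f h : K[X]} (hfh : f * h = X ^ n - 1)
    (w : Fin n → K) :
    (∀ u : Fin n → K, f ∣ vecPoly n u → ∑ i, u i * w i = 0) ↔ h.reverse ∣ vecPoly n w := by
  have hN := monic_X_pow_sub_one (K := K) hn
  have hf : f ≠ 0 := fun e => hN.ne_zero (by rw [← hfh, e, zero_mul])
  have h0 : h.coeff 0 ≠ 0 := by
    intro e
    have := congrArg (coeff · 0) hfh
    simp [mul_coeff_zero, e, hn.ne] at this
  have hw := natDegree_vecPoly_le n w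
  have key (u : Fin n → K) : (vecPoly n u * reflect (n - 1) (vecPoly n w)).natDegree ≤
      (n - 1) + (n - 1) :=
    natDegree_mul_le.trans (add_le_add (natDegree_vecPoly_le n u) (natDegree_reflect_le_of_le hw))
  rw [← dvd_reflect_iff h0 hw, ← mul_dvd_mul_iff_left hf, hfh]
  constructor
  · intro H
    refine X_pow_sub_one_dvd_of_coeff_modByMonic hn fun i => ?_
    have hd := natDegree_modByMonic_X_pow_sub_one_le hn (X ^ i * f)
    have hu := vecPoly_coeff hn hd
    have hfu : f ∣ (X ^ i * f) %ₘ (X ^ n - 1) := by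
      rw [modByMonic_eq_sub_mul_div]
      exact dvd_sub (dvd_mul_left _ _) ((Dvd.intro _ hfh).mul_right _)
    have := H _ (hu.symm ▸ hfu)
    rw [sum_mul_eq_coeff_mul_reflect hn, ← coeff_modByMonic_X_pow_sub_one hn (key _), hu] at this
    rw [← this]
    congr 1
    refine modByMonic_eq_of_dvd_sub hN ?_
    rw [← mul_assoc, ← sub_mul, ← dvd_neg, ← neg_mul, neg_sub]
    exact (dvd_modByMonic_sub _ _).mul_right _
  · rintro H u ⟨k, hk⟩
    rw [sum_mul_eq_coeff_mul_reflect hn, ← coeff_modByMonic_X_pow_sub_one hn (key _), hk,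
      (modByMonic_eq_zero_iff_dvd hN).mpr, coeff_zero]
    rw [mul_right_comm]
    exact H.mul_right k

/-- A vector orthogonal to the shortened code extends to a vector of the dual code. -/
theorem exists_extend_orthogonal {ι κ : Type*} [Fintype ι] [Fintype κ]
    (D : Submodule K ((ι → K) × (κ → K))) (w : κ → K)
    (hw : ∀ u : κ → K, (0, u) ∈ D → ∑ j, u j * w j = 0) :
    ∃ v : ι → K, ∀ u ∈ D, (∑ i, u.1 i * v i) + ∑ j, u.2 j * w j = 0 := by
  classical
  let f : Module.Dual K D := -(dotProductBilin K K w ∘ₗ LinearMap.snd K _ _ ∘ₗ D.subtype)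
  let π : D →ₗ[K] (ι → K) := LinearMap.fst K _ _ ∘ₗ D.subtype
  have hf : f ∈ LinearMap.range π.dualMap := by
    rw [LinearMap.range_dualMap_eq_dualAnnihilator_ker, Submodule.mem_dualAnnihilator]
    rintro ⟨⟨u₁, u₂⟩, hu⟩ hu0
    obtain rfl : u₁ = 0 := hu0
    simpa [f, dotProduct, mul_comm] using hw u₂ hu
  obtain ⟨g, hg⟩ := hf
  refine ⟨fun i => g fun j => if i = j then 1 else 0, fun u hu => ?_⟩
  have h1 := LinearMap.congr_fun hg ⟨u, hu⟩
  have h2 := LinearMap.pi_apply_eq_sum_univ g u.1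
  simp only [f, π, dotProduct, LinearMap.dualMap_apply, LinearMap.comp_apply, LinearMap.neg_apply,
    Submodule.subtype_apply, LinearMap.fst_apply, LinearMap.snd_apply, dotProductBilin_apply_apply]
    at h1
  simp only [smul_eq_mul] at h2
  rw [← h2, h1]
  simp [mul_comm]

end

theorem ofVec_eq (n : ℕ) (v : Fin n → ZMod 2) : ofVec n v = mkQ n (vecPoly n v) := rfl

theorem ofVec_zero (n : ℕ) : ofVec n 0 = 0 := by simp [ofVec]

theorem mkQ_eq_mkQ_iff {n : ℕ} {p q : Z2P} : mkQ n p = mkQ n q ↔ (X : Z2P) ^ n - 1 ∣ p - q := by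
  rw [mkQ, Ideal.Quotient.eq, Ideal.mem_span_singleton]

theorem mkQ_eq_zero_iff {n : ℕ} {p : Z2P} : mkQ n p = 0 ↔ (X : Z2P) ^ n - 1 ∣ p := by
  simpa using mkQ_eq_mkQ_iff (n := n) (p := p) (q := 0)

theorem smul_mkQ (n : ℕ) (c p : Z2P) : c • mkQ n p = mkQ n (c * p) := rfl

theorem mkQ_mem_span_singleton_iff {n : ℕ} {a p : Z2P} (ha : a ∣ (X : Z2P) ^ n - 1) :
    mkQ n p ∈ Submodule.span Z2P {mkQ n a} ↔ a ∣ p := by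
  rw [Submodule.mem_span_singleton]
  constructor
  · rintro ⟨c, hc⟩
    rw [smul_mkQ, mkQ_eq_mkQ_iff] at hc
    exact (dvd_sub_right (dvd_mul_left a c)).mp (ha.trans hc)
  · rintro ⟨c, rfl⟩
    exact ⟨c, by rw [smul_mkQ, mul_comm]⟩

/-- The binary vectors whose images under the coefficient identification lie in a code. -/
def vecCode (r s : ℕ) (C : Submodule Z2P (Rq r × Rq s)) :
    Submodule (ZMod 2) ((Fin r → ZMod 2) × (Fin s → ZMod 2)) where
  carrier := {u | (ofVec r u.1, ofVec s u.2) ∈ C}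
  add_mem' {u v} hu hv := by
    simpa [ofVec_eq, vecPoly_add] using C.add_mem hu hv
  zero_mem' := by
    simpa [ofVec_zero] using show ((0, 0) : Rq r × Rq s) ∈ C from C.zero_mem
  smul_mem' c u hu := by
    simpa [ofVec_eq, vecPoly_smul, smul_mkQ] using C.smul_mem (Polynomial.C c) hu

/-- The projection of the dual code is the dual of the shortened code. -/
theorem exists_mem_dualCode_iff {r s : ℕ} (C : Submodule Z2P (Rq r × Rq s)) (q : Rq s) :
    (∃ p : Rq r, (p, q) ∈ dualCode r s C) ↔
      ∃ w : Fin s → ZMod 2, ofVec s w = q ∧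
        ∀ u : Fin s → ZMod 2, (0, ofVec s u) ∈ C → ∑ j, u j * w j = 0 := by
  constructor
  · rintro ⟨p, w, hw, H⟩
    refine ⟨w.2, congrArg Prod.snd hw, fun u hu => ?_⟩
    simpa using H (0, u) (by simpa [ofVec_zero] using hu)
  · rintro ⟨w, rfl, H⟩
    obtain ⟨v, hv⟩ := exists_extend_orthogonal (vecCode r s C) w fun u hu =>
      H u (by simpa [vecCode, ofVec_zero] using hu)
    exact ⟨ofVec r v, (v, w), rfl, fun u hu => hv u hu⟩

/-- If the shortened code is the cyclic code `⟨f⟩` with `f * h = X ^ s - 1`, then the projection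
of the dual code is the cyclic code `⟨h*⟩`. -/
theorem eq_reverse_of_dualCode {r s : ℕ} (hs : 0 < s) {C : Submodule Z2P (Rq r × Rq s)}
    {f h aa : Z2P} (hfh : f * h = X ^ s - 1)
    (hshort : ∀ p : Z2P, (0, mkQ s p) ∈ C ↔ f ∣ p)
    (hmonic : aa.Monic) (haa : aa ∣ (X : Z2P) ^ s - 1)
    (hdual : {q : Rq s | ∃ p : Rq r, (p, q) ∈ dualCode r s C} =
      (Submodule.span Z2P {mkQ s aa} : Set (Rq s))) :
    aa = h.reverse := by
  have hN := monic_X_pow_sub_one (K := ZMod 2) hs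
  have hrev : f.reverse * h.reverse = -(X ^ s - 1) := by
    rw [← reverse_mul_of_domain, hfh, reverse_X_pow_sub_one]
  have hrN : h.reverse ∣ X ^ s - 1 := dvd_neg.mp (Dvd.intro_left _ hrev)
  have hr0 : h.reverse ≠ 0 := ne_zero_of_dvd_ne_zero hN.ne_zero hrN
  have hmem (q : Rq s) : q ∈ Submodule.span Z2P {mkQ s aa} ↔
      ∃ w : Fin s → ZMod 2, ofVec s w = q ∧ h.reverse ∣ vecPoly s w := by
    rw [← SetLike.mem_coe, ← hdual, Set.mem_ofPred_eq, exists_mem_dualCode_iff]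
    simp only [ofVec_eq, hshort, forall_sum_mul_eq_zero_iff hs hfh]
  have hmonic' : h.reverse.Monic := by
    have hu : ∀ c : ZMod 2, c ≠ 0 → c = 1 := by decide
    exact hu _ (leadingCoeff_ne_zero.mpr hr0)
  refine eq_of_monic_of_associated hmonic hmonic' (associated_of_dvd_dvd ?_ ?_)
  · rw [← mkQ_mem_span_singleton_iff haa, hmem]
    have hd := natDegree_modByMonic_X_pow_sub_one_le hs h.reverse
    refine ⟨fun i => (h.reverse %ₘ (X ^ s - 1)).coeff i, ?_, ?_⟩
    · rw [ofVec_eq, vecPoly_coeff hs hd, mkQ_eq_mkQ_iff]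
      exact dvd_modByMonic_sub _ _
    · rw [vecPoly_coeff hs hd, modByMonic_eq_sub_mul_div]
      exact dvd_sub dvd_rfl (hrN.mul_right _)
  · obtain ⟨w, hw, hd⟩ := (hmem _).mp (Submodule.mem_span_singleton_self (mkQ s aa))
    rw [ofVec_eq, mkQ_eq_mkQ_iff] at hw
    exact (dvd_sub_right hd).mp (hrN.trans hw)

/-- Let `C = ⟨(b | 0), (ℓ | a)⟩` be a `Z₂`-double cyclic code (with the canonical conditions
on the generators), and let `ā` be the monic divisor of `x^s−1` generating the projection
`(C^⊥)_s`. Then `ā = (x^s−1)·gcd(b, ℓ)* / (a*·b*)`. -/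
theorem stmt17 (r s : ℕ) (hr : 0 < r) (hs : 0 < s) (b l a aa : Z2P)
    (C : Submodule Z2P (Rq r × Rq s))
    (hCdef : C = Submodule.span Z2P {((mkQ r b, 0) : Rq r × Rq s), (mkQ r l, mkQ s a)})
    (hb : b ∣ (X : Z2P) ^ r - 1) (ha : a ∣ (X : Z2P) ^ s - 1)
    (hker : C ⊓ LinearMap.ker (LinearMap.snd Z2P (Rq r) (Rq s)) =
      Submodule.span Z2P {((mkQ r b, 0) : Rq r × Rq s)})
    (hCs : Submodule.map (LinearMap.snd Z2P (Rq r) (Rq s)) C =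
      Submodule.span Z2P {mkQ s a})
    (haamonic : aa.Monic) (haa : aa ∣ (X : Z2P) ^ s - 1)
    (hCsdual : {q : Rq s | ∃ p : Rq r, (p, q) ∈ dualCode r s C} =
      (Submodule.span Z2P {mkQ s aa} : Set (Rq s))) :
    aa = (((X : Z2P) ^ s - 1) * (gcd b l).reverse) / (a.reverse * b.reverse) := by
  obtain ⟨b', l', hb', hl', hunit⟩ := extract_gcd b l
  have hcop : IsRelPrime b' l' := gcd_isUnit_iff_isRelPrime.mp hunit
  set g := gcd b l
  clear_value g
  have hNr := (monic_X_pow_sub_one (K := ZMod 2) hr).ne_zero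
  have hNs := (monic_X_pow_sub_one (K := ZMod 2) hs).ne_zero
  have hb0 : b ≠ 0 := ne_zero_of_dvd_ne_zero hNr hb
  have hg0 : g ≠ 0 := fun e => hb0 (by rw [hb', e, zero_mul])
  have hdvd {c : Z2P} (hc : b ∣ c * l) : b' ∣ c := by
    rw [hb', hl', mul_left_comm, mul_dvd_mul_iff_left hg0] at hc
    exact hcop.dvd_of_dvd_mul_right hc
  have hla : ((mkQ r l, mkQ s a) : Rq r × Rq s) ∈ C := hCdef ▸ Submodule.subset_span (by simp)
  have hb0C : ((mkQ r b, 0) : Rq r × Rq s) ∈ C := hCdef ▸ Submodule.subset_span (by simp)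
  obtain ⟨d, hd⟩ := ha
  obtain ⟨h, rfl⟩ : b' ∣ d := by
    apply hdvd
    have hmem : ((mkQ r (d * l), 0) : Rq r × Rq s) ∈
        C ⊓ LinearMap.ker (LinearMap.snd Z2P (Rq r) (Rq s)) := by
      refine ⟨?_, rfl⟩
      have := C.smul_mem d hla
      rwa [Prod.smul_mk, smul_mkQ, smul_mkQ, mul_comm d a, ← hd,
        mkQ_eq_zero_iff.mpr dvd_rfl] at this
    rw [hker, Submodule.mem_span_singleton] at hmem
    obtain ⟨c, hc⟩ := hmem
    have hc1 := congrArg Prod.fst hc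
    rw [Prod.smul_mk, smul_mkQ, mkQ_eq_mkQ_iff] at hc1
    exact (dvd_sub_right (dvd_mul_left b c)).mp (hb.trans hc1)
  have hfh : a * b' * h = X ^ s - 1 := by rw [hd, mul_assoc]
  have hshort (p : Z2P) : ((0, mkQ s p) : Rq r × Rq s) ∈ C ↔ a * b' ∣ p := by
    constructor
    · intro hp
      rw [hCdef, Submodule.mem_span_pair] at hp
      obtain ⟨x, y, hxy⟩ := hp
      have h1 := congrArg Prod.fst hxy
      have h2 := congrArg Prod.snd hxy
      simp only [Prod.smul_mk, Prod.mk_add_mk, smul_mkQ, smul_zero, zero_add, ← map_add] at h1 h2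
      rw [mkQ_eq_zero_iff] at h1
      rw [mkQ_eq_mkQ_iff] at h2
      have hy : b' ∣ y := hdvd ((dvd_add_right (dvd_mul_left b x)).mp (hb.trans h1))
      have hya : a * b' ∣ y * a := by
        rw [mul_comm y]
        exact mul_dvd_mul_left a hy
      exact (dvd_sub_right hya).mp ((Dvd.intro _ hfh).trans h2)
    · rintro ⟨c, rfl⟩
      have := C.smul_mem c (C.sub_mem (C.smul_mem b' hla) (C.smul_mem l' hb0C))
      simp only [Prod.smul_mk, Prod.mk_sub_mk, smul_mkQ, smul_zero, sub_zero, ← map_sub] at this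
      convert this using 2
      · rw [hb', hl', eq_comm]
        convert map_zero (mkQ r)
        ring
      · congr 1
        ring
  rw [eq_reverse_of_dualCode hs hfh hshort haamonic haa hCsdual]
  have hrev : (a.reverse * b'.reverse) * h.reverse = X ^ s - 1 := by
    rw [← reverse_mul_of_domain, ← reverse_mul_of_domain, hfh, reverse_X_pow_sub_one, CharTwo.neg_eq]
  have ha0 : a ≠ 0 := fun e => hNs (by rw [hd, e, zero_mul])
  refine EuclideanDomain.eq_div_of_mul_eq_left ?_ ?_
  · exact mul_ne_zero (by simpa using ha0) (by simpa using hb0)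
  · rw [hb', reverse_mul_of_domain, ← hrev]
    ring
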